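/- Let G⁗ be the graph obtained from G(L⁽¹⁾,x,y,l,m) by replacing the copy Lₘ with a copy of L⁽⁴⁾ (with its distinguished vertices x = w₄, y = w₅ playing the roles of xₘ, yₘ). For all integers l ≥ 2 and m ≥ 1, the toughness of G⁗ equals (l + 4m − 2)/(2m). -/

import Mathlib

open SimpleGraph

/-- Number of connected components of the subgraph induced on the complement of `S`. -/
noncomputable def numComponents {V : Type} (G : SimpleGraph V) (S : Set V) : ℕ :=
  Nat.card (G.induce Sᶜ).ConnectedComponent

/-- `G` is `t`-tough: `|S| ≥ t · ω(G \ S)` for every vertex subset `S`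
with `ω(G \ S) > 1`. -/
def IsTough {V : Type} (t : ℝ) (G : SimpleGraph V) : Prop :=
  ∀ S : Finset V, 1 < numComponents G ↑S →
    t * (numComponents G ↑S : ℝ) ≤ (S.card : ℝ)

/-- The toughness of `G` equals `t`: `t` is the greatest nonnegative real
for which `G` is `t`-tough. -/
def HasToughness {V : Type} (G : SimpleGraph V) (t : ℝ) : Prop :=
  IsGreatest {s : ℝ | 0 ≤ s ∧ IsTough s G} t

/-- A Hamiltonian cycle: a cycle whose support contains every vertex. -/
def IsHamCycle {V : Type} {G : SimpleGraph V} {v : V} (p : G.Walk v v) : Prop :=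
  p.IsCycle ∧ ∀ u, u ∈ p.support

/-- A graph is Hamiltonian if it contains a Hamiltonian cycle. -/
def IsHam {V : Type} (G : SimpleGraph V) : Prop :=
  ∃ (v : V) (p : G.Walk v v), IsHamCycle p

/-- `x` and `y` are connected by a Hamilton path of `G`: a path with endpoints
`x` and `y` containing every vertex of `G`. -/
def HamConnected {V : Type} (G : SimpleGraph V) (x y : V) : Prop :=
  ∃ p : G.Walk x y, p.IsPath ∧ ∀ v, v ∈ p.support

/-- `L⁽¹⁾`: the 8-cycle `w₁w₂…w₈w₁` (here `wᵢ = i - 1`) together with the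
edges `w₂w₄, w₄w₆, w₆w₈, w₂w₈`; `x = w₁ = 0`, `y = w₅ = 4`. -/
def L1 : SimpleGraph (Fin 8) := SimpleGraph.fromEdgeSet
  {s(0,1), s(1,2), s(2,3), s(3,4), s(4,5), s(5,6), s(6,7), s(7,0),
   s(1,3), s(3,5), s(5,7), s(1,7)}

/-- `L⁽²⁾`: obtained from `L⁽¹⁾` by deleting `w₁w₂, w₂w₈` and identifying `w₂`
with `w₈`.  Vertices `w₁, w, w₃, w₄, w₅, w₆, w₇` are `0, 1, 2, 3, 4, 5, 6`;
`x = w₁ = 0`, `y = w₅ = 4`. -/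
def L2 : SimpleGraph (Fin 7) := SimpleGraph.fromEdgeSet
  {s(0,1), s(1,2), s(2,3), s(3,4), s(4,5), s(5,6), s(6,1),
   s(1,3), s(3,5), s(5,1)}

/-- `L⁽³⁾`: obtained from `L⁽¹⁾` by adding a new vertex `w₉ = 8` and the edges
`w₄w₉, w₆w₉`; `x = w₁ = 0`, `y = w₅ = 4`. -/
def L3 : SimpleGraph (Fin 9) := SimpleGraph.fromEdgeSet
  {s(0,1), s(1,2), s(2,3), s(3,4), s(4,5), s(5,6), s(6,7), s(7,0),
   s(1,3), s(3,5), s(5,7), s(1,7), s(3,8), s(5,8)}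

/-- `L⁽⁴⁾`: the triangle `w₁w₂w₃w₁` together with pendant vertices `w₄, w₅`
and edges `w₁w₄, w₃w₅` (here `wᵢ = i - 1`); `x = w₄ = 3`, `y = w₅ = 4`. -/
def L4 : SimpleGraph (Fin 5) := SimpleGraph.fromEdgeSet
  {s(0,1), s(1,2), s(2,0), s(0,3), s(2,4)}

/-- A building block: a graph together with two distinguished vertices. -/
structure Block where
  V : Type
  G : SimpleGraph V
  x : V
  y : V

/-- The graph `G(L,x,y,l,m)` (allowing a different block for each of the `m`
copies): disjoint copies `L₁, …, Lₘ` of the blocks, all possible edges between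
pairs of vertices in `{x₁, …, xₘ, y₁, …, yₘ}`, joined with a complete graph
`T = Kₗ`. -/
def GGen {m : ℕ} (l : ℕ) (B : Fin m → Block) :
    SimpleGraph (Fin l ⊕ Σ i, (B i).V) :=
  SimpleGraph.fromRel fun a b =>
    (∃ t, a = Sum.inl t) ∨ (∃ t, b = Sum.inl t) ∨
    (∃ (i : Fin m) (u v : (B i).V),
      a = Sum.inr ⟨i, u⟩ ∧ b = Sum.inr ⟨i, v⟩ ∧ (B i).G.Adj u v) ∨
    (∃ p q : Σ i, (B i).V, a = Sum.inr p ∧ b = Sum.inr q ∧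
      (p.2 = (B p.1).x ∨ p.2 = (B p.1).y) ∧ (q.2 = (B q.1).x ∨ q.2 = (B q.1).y))

def blockL1 : Block := ⟨Fin 8, L1, 0, 4⟩
def blockL2 : Block := ⟨Fin 7, L2, 0, 4⟩
def blockL3 : Block := ⟨Fin 9, L3, 0, 4⟩
def blockL4 : Block := ⟨Fin 5, L4, 3, 4⟩

/-- Every vertex set `S` of the block can be matched with at most `k` representatives, and at most
half as many as `S` has elements, such that every vertex outside `S` is linked, by a path of length
at most two avoiding `S`, to a representative or to a distinguished vertex. -/
def Block.HasReps (b : Block) (k : ℕ) : Prop :=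
  ∀ S : Finset b.V, ∃ R : Finset b.V, 2 * R.card ≤ S.card ∧ R.card ≤ k ∧
    ∀ v, v ∉ S → ∃ r, r ∉ S ∧ (r = b.x ∨ r = b.y ∨ r ∈ R) ∧
      (v = r ∨ b.G.Adj v r ∨ ∃ w, w ∉ S ∧ b.G.Adj v w ∧ b.G.Adj w r)

/-- At most `2 * k` vertices of the block separate `k` parts from each other and from the
distinguished vertices. -/
def Block.HasCut (b : Block) (k : ℕ) : Prop :=
  ∃ (D : Finset b.V) (f : b.V → Option (Fin k)), D.card ≤ 2 * k ∧ b.x ∉ D ∧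
    f b.x = none ∧ f b.y = none ∧
    (∀ u v, u ∉ D → v ∉ D → b.G.Adj u v → f u = f v) ∧ ∀ j, ∃ v, v ∉ D ∧ f v = some j

instance : DecidableRel L1.Adj := by unfold L1; infer_instance

instance : DecidableRel L4.Adj := by unfold L4; infer_instance

theorem blockL1_hasReps : blockL1.HasReps 2 := by
  unfold Block.HasReps blockL1
  decide +kernel

theorem blockL4_hasReps : blockL4.HasReps 1 := by
  unfold Block.HasReps blockL4
  decide +kernel

theorem blockL1_hasCut : blockL1.HasCut 2 :=
  ⟨({1, 3, 5, 7} : Finset (Fin 8)), ![none, none, some 0, none, none, none, some 1, none], by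
    unfold blockL1
    decide +kernel⟩

theorem blockL4_hasCut : blockL4.HasCut 1 :=
  ⟨({0, 2} : Finset (Fin 5)), ![none, some 0, none, none, none], by
    unfold blockL4
    decide +kernel⟩

section GGen

variable {m l : ℕ} {B : Fin m → Block}

theorem GGen_adj_inl (t : Fin l) {a : Fin l ⊕ Σ i, (B i).V} (h : Sum.inl t ≠ a) :
    (GGen l B).Adj (Sum.inl t) a :=
  (SimpleGraph.fromRel_adj _ _ _).2 ⟨h, Or.inl (Or.inl ⟨t, rfl⟩)⟩

theorem GGen_adj_block {i : Fin m} {u v : (B i).V} (h : (B i).G.Adj u v) :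
    (GGen l B).Adj (Sum.inr ⟨i, u⟩) (Sum.inr ⟨i, v⟩) :=
  (SimpleGraph.fromRel_adj _ _ _).2 ⟨fun e => h.ne (by simpa using e),
    Or.inl (Or.inr (Or.inr (Or.inl ⟨i, u, v, rfl, rfl, h⟩)))⟩

theorem GGen_adj_distinguished {p q : Σ i, (B i).V} (hpq : p ≠ q)
    (hp : p.2 = (B p.1).x ∨ p.2 = (B p.1).y) (hq : q.2 = (B q.1).x ∨ q.2 = (B q.1).y) :
    (GGen l B).Adj (Sum.inr p) (Sum.inr q) :=
  (SimpleGraph.fromRel_adj _ _ _).2 ⟨fun e => hpq (Sum.inr_injective e),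
    Or.inl (Or.inr (Or.inr (Or.inr ⟨p, q, rfl, rfl, hp, hq⟩)))⟩

theorem GGen_adj_inr {p q : Σ i, (B i).V} (h : (GGen l B).Adj (Sum.inr p) (Sum.inr q)) :
    (∃ (i : Fin m) (u v : (B i).V), p = ⟨i, u⟩ ∧ q = ⟨i, v⟩ ∧ (B i).G.Adj u v) ∨
    ((p.2 = (B p.1).x ∨ p.2 = (B p.1).y) ∧ (q.2 = (B q.1).x ∨ q.2 = (B q.1).y)) := by
  obtain ⟨-, h | h⟩ := (SimpleGraph.fromRel_adj _ _ _).1 h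
  · rcases h with ⟨t, h⟩ | ⟨t, h⟩ | ⟨i, u, v, h, h', ha⟩ | ⟨p', q', h, h', hp, hq⟩
    · simp at h
    · simp at h
    · exact Or.inl ⟨i, u, v, Sum.inr_injective h, Sum.inr_injective h', ha⟩
    · cases h
      cases h'
      exact Or.inr ⟨hp, hq⟩
  · rcases h with ⟨t, h⟩ | ⟨t, h⟩ | ⟨i, u, v, h, h', ha⟩ | ⟨p', q', h, h', hp, hq⟩
    · simp at h
    · simp at h
    · exact Or.inl ⟨i, v, u, Sum.inr_injective h', Sum.inr_injective h, ha.symm⟩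
    · cases h
      cases h'
      exact Or.inr ⟨hq, hp⟩

theorem inl_mem_of_one_lt_numComponents {S : Finset (Fin l ⊕ Σ i, (B i).V)}
    (hS : 1 < numComponents (GGen l B) ↑S) (t : Fin l) : Sum.inl t ∈ S := by
  by_contra ht
  have key : ∀ a : ↥(S : Set (Fin l ⊕ Σ i, (B i).V))ᶜ,
      ((GGen l B).induce (S : Set _)ᶜ).Reachable ⟨Sum.inl t, ht⟩ a := by
    rintro ⟨a, ha⟩
    by_cases e : Sum.inl t = a
    · subst e
      exact Reachable.rfl
    · exact Adj.reachable (GGen_adj_inl t e)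
  have : Subsingleton ((GGen l B).induce (S : Set _)ᶜ).ConnectedComponent := by
    refine ⟨fun c d => ?_⟩
    induction c using ConnectedComponent.ind with | _ a =>
    induction d using ConnectedComponent.ind with | _ b =>
    exact ConnectedComponent.sound ((key a).symm.trans (key b))
  exact hS.not_ge (Finite.card_le_one_iff_subsingleton.2 this)

theorem numComponents_GGen_le {k : Fin m → ℕ} (hB : ∀ i, (B i).HasReps (k i))
    {S : Finset (Fin l ⊕ Σ i, (B i).V)} (hS : 1 < numComponents (GGen l B) ↑S) :
    numComponents (GGen l B) ↑S ≤ 1 + ∑ i, k i ∧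
      l + 2 * numComponents (GGen l B) ↑S ≤ S.card + 2 := by
  classical
  have hT := inl_mem_of_one_lt_numComponents hS
  have hinj (i : Fin m) :
      Function.Injective (fun v => (Sum.inr ⟨i, v⟩ : Fin l ⊕ Σ i, (B i).V)) :=
    fun u v h => by simpa using h
  set Si : ∀ i, Finset (B i).V :=
    fun i => S.preimage (fun v => Sum.inr ⟨i, v⟩) (hinj i).injOn with hSi
  have hmem (i : Fin m) (v : (B i).V) : v ∈ Si i ↔ Sum.inr ⟨i, v⟩ ∈ S := by
    simp [hSi]
  have hcard : S.card = l + ∑ i, (Si i).card := by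
    have : S = Finset.disjSum Finset.univ (Finset.univ.sigma Si) := by
      ext (t | ⟨i, v⟩)
      · simp [hT t]
      · simp [hmem]
    rw [this]
    simp
  choose R hR1 hR2 hR3 using fun i => hB i (Si i)
  set C := ((GGen l B).induce (S : Set (Fin l ⊕ Σ i, (B i).V))ᶜ).ConnectedComponent with hC
  have hne : Nonempty C := by
    by_contra h
    rw [not_nonempty_iff] at h
    simp [numComponents, ← hC] at hS
  let comp (a : Fin l ⊕ Σ i, (B i).V) : C :=
    if h : a ∉ S then connectedComponentMk _ ⟨a, h⟩ else Classical.arbitrary C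
  have comp_adj {a b} (ha : a ∉ S) (hb : b ∉ S) (hab : (GGen l B).Adj a b) :
      comp a = comp b := by
    simp only [comp, dif_pos ha, dif_pos hb]
    exact ConnectedComponent.sound (Adj.reachable (by exact hab))
  obtain ⟨c₀, hc₀⟩ : ∃ c₀ : C, ∀ p : Σ i, (B i).V, (p.2 = (B p.1).x ∨ p.2 = (B p.1).y) →
      Sum.inr p ∉ S → comp (Sum.inr p) = c₀ := by
    by_cases h : ∃ p : Σ i, (B i).V, (p.2 = (B p.1).x ∨ p.2 = (B p.1).y) ∧ Sum.inr p ∉ S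
    · obtain ⟨p, hp, hpS⟩ := h
      refine ⟨comp (Sum.inr p), fun q hq hqS => ?_⟩
      by_cases e : q = p
      · rw [e]
      · exact comp_adj hqS hpS (GGen_adj_distinguished e hq hp)
    · exact ⟨Classical.arbitrary C, fun p hp hpS => (h ⟨p, hp, hpS⟩).elim⟩
  let g : Option (Σ i, R i) → C
    | none => c₀
    | some r => comp (Sum.inr ⟨r.1, r.2⟩)
  have hg : Function.Surjective g := by
    intro c
    induction c using ConnectedComponent.ind with | _ a =>
    obtain ⟨a, ha⟩ := a
    have hca : comp a = connectedComponentMk _ ⟨a, ha⟩ := dif_pos ha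
    rw [← hca]
    obtain t | ⟨i, v⟩ := a
    · exact (ha (hT t)).elim
    obtain ⟨r, hrS, hr, hvr⟩ := hR3 i v (fun h => ha ((hmem i v).1 h))
    rw [hmem] at hrS
    have hcomp : comp (Sum.inr ⟨i, v⟩) = comp (Sum.inr ⟨i, r⟩) := by
      rcases hvr with rfl | h | ⟨w, hw, h, h'⟩
      · rfl
      · exact comp_adj ha hrS (GGen_adj_block h)
      · rw [hmem] at hw
        exact (comp_adj ha hw (GGen_adj_block h)).trans (comp_adj hw hrS (GGen_adj_block h'))
    rw [hcomp]
    rcases hr with h | h | h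
    · exact ⟨none, (hc₀ ⟨i, r⟩ (Or.inl h) hrS).symm⟩
    · exact ⟨none, (hc₀ ⟨i, r⟩ (Or.inr h) hrS).symm⟩
    · exact ⟨some ⟨i, r, h⟩, rfl⟩
  have hle : numComponents (GGen l B) ↑S ≤ 1 + ∑ i, (R i).card := by
    have := Nat.card_le_card_of_surjective g hg
    rw [Nat.card_eq_fintype_card (α := Option _)] at this
    simp only [Fintype.card_option, Fintype.card_sigma, Fintype.card_coe] at this
    exact this.trans (Nat.add_comm _ _).le
  have h1 : ∑ i, (R i).card ≤ ∑ i, k i := Finset.sum_le_sum fun i _ => hR2 i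
  have h2 : 2 * ∑ i, (R i).card ≤ ∑ i, (Si i).card := by
    rw [Finset.mul_sum]
    exact Finset.sum_le_sum fun i _ => hR1 i
  omega

theorem exists_le_numComponents_GGen [NeZero m] [∀ i, Finite (B i).V] {k : Fin m → ℕ}
    (hB : ∀ i, (B i).HasCut (k i)) :
    ∃ S : Finset (Fin l ⊕ Σ i, (B i).V), S.card ≤ l + 2 * ∑ i, k i ∧
      1 + ∑ i, k i ≤ numComponents (GGen l B) ↑S := by
  classical
  choose D f hD hxD hx hy hadj hsurj using hB
  let S : Finset (Fin l ⊕ Σ i, (B i).V) :=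
    Finset.disjSum Finset.univ (Finset.univ.sigma D)
  have hmem (i : Fin m) (v : (B i).V) : Sum.inr ⟨i, v⟩ ∈ S ↔ v ∈ D i := by
    simp [S]
  refine ⟨S, ?_, ?_⟩
  · simp only [S, Finset.card_disjSum, Finset.card_sigma, Finset.card_univ, Fintype.card_fin,
      Finset.mul_sum]
    exact Nat.add_le_add_left (Finset.sum_le_sum fun i _ => hD i) l
  let label : (Fin l ⊕ Σ i, (B i).V) → Option (Σ i, Fin (k i))
    | Sum.inl _ => none
    | Sum.inr p => (f p.1 p.2).map (Sigma.mk p.1)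
  have label_distinguished (p : Σ i, (B i).V) (hp : p.2 = (B p.1).x ∨ p.2 = (B p.1).y) :
      label (Sum.inr p) = none := by
    rcases hp with h | h <;> simp [label, h, hx, hy]
  have label_adj {a b} (ha : a ∉ S) (hb : b ∉ S) (hab : (GGen l B).Adj a b) :
      label a = label b := by
    obtain t | p := a
    · simp [S] at ha
    obtain t | q := b
    · simp [S] at hb
    obtain ⟨i, u, v, rfl, rfl, h⟩ | ⟨hp, hq⟩ := GGen_adj_inr hab
    · rw [hmem] at ha hb
      simp only [label, hadj i u v ha hb h]
    · rw [label_distinguished p hp, label_distinguished q hq]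
  let g : ((GGen l B).induce (S : Set (Fin l ⊕ Σ i, (B i).V))ᶜ).ConnectedComponent →
      Option (Σ i, Fin (k i)) :=
    ConnectedComponent.lift (fun a => label a.1) (by
      intro a b p _
      induction p with
      | nil => rfl
      | @cons a b c h p ih => exact (label_adj a.2 b.2 h).trans (ih (by simp_all)))
  have hg : Function.Surjective g := by
    rintro (_ | ⟨i, j⟩)
    · exact ⟨connectedComponentMk _ ⟨Sum.inr ⟨0, (B 0).x⟩, fun h => hxD 0 ((hmem _ _).1 h)⟩,
        label_distinguished _ (Or.inl rfl)⟩
    · obtain ⟨v, hv, hvj⟩ := hsurj i j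
      exact ⟨connectedComponentMk _ ⟨Sum.inr ⟨i, v⟩, fun h => hv ((hmem _ _).1 h)⟩,
        by simp [g, label, hvj]⟩
  have := Nat.card_le_card_of_surjective g hg
  rw [Nat.card_eq_fintype_card (α := Option _)] at this
  simp only [Fintype.card_option, Fintype.card_sigma, Fintype.card_fin] at this
  unfold numComponents
  omega

end GGen

/-- Claim 7: for `l ≥ 2` and `m ≥ 1`, the graph `G⁗` obtained from
`G(L⁽¹⁾,x,y,l,m)` by replacing the copy `Lₘ` with a copy of `L⁽⁴⁾` has
toughness `(l + 4m - 2)/(2m)`. -/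
theorem toughness_GGen_L1_L4 (l m : ℕ) (hl : 2 ≤ l) (hm : 1 ≤ m) :
    HasToughness
      (GGen l (fun i : Fin m => if (i : ℕ) = m - 1 then blockL4 else blockL1))
      (((l : ℝ) + 4 * m - 2) / (2 * m)) := by
  classical
  set B : Fin m → Block := fun i : Fin m => if (i : ℕ) = m - 1 then blockL4 else blockL1 with hB
  set k : Fin m → ℕ := fun i : Fin m => if (i : ℕ) = m - 1 then 1 else 2 with hk
  have hreps (i : Fin m) : (B i).HasReps (k i) := by
    simp only [hB, hk]
    split_ifs
    exacts [blockL4_hasReps, blockL1_hasReps]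
  have hcut (i : Fin m) : (B i).HasCut (k i) := by
    simp only [hB, hk]
    split_ifs
    exacts [blockL4_hasCut, blockL1_hasCut]
  have hfin (i : Fin m) : Finite (B i).V := by
    simp only [hB]
    split_ifs
    exacts [inferInstanceAs (Finite (Fin 5)), inferInstanceAs (Finite (Fin 8))]
  have hsum : 1 + ∑ i, k i = 2 * m := by
    obtain ⟨n, rfl⟩ := Nat.exists_eq_add_of_le' hm
    simp [hk, Fin.sum_univ_castSucc, fun i : Fin n => i.isLt.ne]
    omega
  have : NeZero m := ⟨by omega⟩
  have hm' : (1 : ℝ) ≤ m := by exact_mod_cast hm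
  have hl' : (2 : ℝ) ≤ l := by exact_mod_cast hl
  refine ⟨⟨div_nonneg (by linarith) (by linarith), fun S hS => ?_⟩, fun t ht => ?_⟩
  · obtain ⟨h1, h2⟩ := numComponents_GGen_le hreps hS
    rw [hsum] at h1
    generalize numComponents (GGen l B) ↑S = c at h1 h2 ⊢
    have h1' : (c : ℝ) ≤ 2 * m := by exact_mod_cast h1
    have h2' : (l : ℝ) + 2 * c ≤ S.card + 2 := by exact_mod_cast h2
    rw [div_mul_eq_mul_div, div_le_iff₀ (by linarith)]
    nlinarith [mul_nonneg (sub_nonneg.2 hl') (sub_nonneg.2 h1')]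
  · obtain ⟨ht0, ht⟩ := ht
    obtain ⟨S, hS, hc⟩ := exists_le_numComponents_GGen (l := l) hcut
    rw [hsum] at hc
    have h := ht S (lt_of_lt_of_le (by omega) hc)
    have hS' : (S.card : ℝ) + 2 ≤ l + 4 * m := by exact_mod_cast (by omega : S.card + 2 ≤ l + 4 * m)
    have hc' : (2 * m : ℝ) ≤ numComponents (GGen l B) ↑S := by exact_mod_cast hc
    rw [le_div_iff₀ (by linarith)]
    linarith [mul_le_mul_of_nonneg_left hc' ht0]
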